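/- arXiv:1103.2427 — 3 statements merged into one kernel-verified Lean document; each statement's English description precedes it below -/
import Mathlib

section
/- For every c ≥ 3 with c ≡ 1 or 2 (mod 4) and every even k ≥ 4, γ(P(ck,k)) ≤ ck/2 + k/2 − 1 + ⌊c/4⌋. -/
open SimpleGraph

/-- The generalized Petersen graph P(n,k): outer vertices `Sum.inl i`,
inner vertices `Sum.inr i`, indices in `ZMod n`. -/
def petersen (n k : ℕ) : SimpleGraph (ZMod n ⊕ ZMod n) :=
  SimpleGraph.fromRel (fun a b =>
    match a, b with
    | Sum.inl i, Sum.inl j => j = i + 1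
    | Sum.inl i, Sum.inr j => j = i
    | Sum.inr i, Sum.inr j => j = i + (k : ZMod n)
    | _, _ => False)

/-- S is a dominating set: N[S] = V. -/
def IsDominating {V : Type*} (G : SimpleGraph V) (S : Set V) : Prop :=
  ∀ v, v ∈ S ∨ ∃ u ∈ S, G.Adj u v

/-- The domination number: minimum cardinality of a (finite) dominating set. -/
noncomputable def gamma {V : Type*} (G : SimpleGraph V) : ℕ :=
  sInf {m | ∃ S : Finset V, IsDominating G ↑S ∧ S.card = m}

/-! The index `r * k + j` of `P(ck,k)` is viewed as the cell in row `r`, column `j` of a `c × k` array.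
A dominating set is described by a finite table whose last four rows and last four
columns may be repeated arbitrarily often. -/

/-- Entry of a table: bit 0 says that the outer vertex is chosen, bit 1 the inner one. -/
def ent (T : List (List ℕ)) (r j : ℕ) : ℕ := (T.getD r []).getD j 0

def cA (T : List (List ℕ)) (r j : ℕ) : Bool := ent T r j % 2 == 1
def cB (T : List (List ℕ)) (r j : ℕ) : Bool := ent T r j / 2 == 1

/-- Class of a row (column) number: the last four classes repeat. -/
def cls (a r : ℕ) : ℕ := if r < a then r else a + (r - a) % 4

/-- possible classes of the cyclic predecessor -/
def prevs (a x : ℕ) : List ℕ :=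
  if x = 0 then [a - 1, a + 3] else if x = a then [a - 1, a + 3] else [x - 1]

/-- possible classes of the cyclic successor -/
def nexts (a x : ℕ) : List ℕ :=
  if x = a + 3 then [a, 0] else if x + 1 = a then [a, 0] else [x + 1]

def lefts (a b x y : ℕ) : List (ℕ × ℕ) :=
  if y = 0 then (prevs a x).flatMap (fun z => [(z, b - 1), (z, b + 3)])
  else if y = b then [(x, b - 1), (x, b + 3)] else [(x, y - 1)]

def rights (a b x y : ℕ) : List (ℕ × ℕ) :=
  if y = b + 3 then (x, b) :: (nexts a x).map (fun z => (z, 0))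
  else if y + 1 = b then (x, b) :: (nexts a x).map (fun z => (z, 0))
  else [(x, y + 1)]

def check (T : List (List ℕ)) (a b : ℕ) : Bool :=
  (List.range (a + 4)).all fun x => (List.range (b + 4)).all fun y =>
    ((lefts a b x y).all fun l => (rights a b x y).all fun r =>
      cA T x y || cB T x y || cA T l.1 l.2 || cA T r.1 r.2) &&
    ((prevs a x).all fun l => (nexts a x).all fun r =>
      cB T x y || cA T x y || cB T l y || cB T r y)

/-- Sum of a function over a row (column) direction. -/
def lin (a m : ℕ) (f : ℕ → ℕ) : ℕ :=
  ((List.range a).map f).sum + m * (f a + f (a + 1) + f (a + 2) + f (a + 3))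

theorem sum_cls (a m : ℕ) (f : ℕ → ℕ) :
    ∑ r ∈ Finset.range (a + 4 * m), f (cls a r) = lin a m f := by
  induction m with
  | zero =>
    simp only [lin, Nat.mul_zero, Nat.add_zero, Nat.zero_mul]
    have e : ((List.range a).map f).sum = ∑ r ∈ Finset.range a, f r := by
      simp [Finset.sum, Finset.range, Multiset.range]
    rw [e]
    refine Finset.sum_congr rfl fun r hr => ?_
    rw [cls, if_pos (Finset.mem_range.1 hr)]
  | succ m ih =>
    have e : a + 4 * (m + 1) = a + 4 * m + 1 + 1 + 1 + 1 := by ring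
    rw [e, Finset.sum_range_succ, Finset.sum_range_succ, Finset.sum_range_succ,
      Finset.sum_range_succ, ih]
    have h0 : cls a (a + 4 * m) = a := by unfold cls; split_ifs <;> omega
    have h1 : cls a (a + 4 * m + 1) = a + 1 := by unfold cls; split_ifs <;> omega
    have h2 : cls a (a + 4 * m + 1 + 1) = a + 2 := by unfold cls; split_ifs <;> omega
    have h3 : cls a (a + 4 * m + 1 + 1 + 1) = a + 3 := by unfold cls; split_ifs <;> omega
    rw [h0, h1, h2, h3]
    unfold lin
    ring

theorem cls_lt (a r : ℕ) : cls a r < a + 4 := by unfold cls; split_ifs <;> omega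

theorem cls_next (a m r : ℕ) (ha : 2 ≤ a) (hr : r < a + 4 * m) :
    cls a (if r + 1 = a + 4 * m then 0 else r + 1) ∈ nexts a (cls a r) := by
  have key : ∀ x y, y = cls a r → x = cls a (if r + 1 = a + 4 * m then 0 else r + 1) →
      (y = a + 3 ∧ (x = a ∨ x = 0)) ∨ (y + 1 = a ∧ (x = a ∨ x = 0)) ∨
      (y ≠ a + 3 ∧ y + 1 ≠ a ∧ x = y + 1) := by
    intro x y hy hx
    unfold cls at hx hy
    split_ifs at hx hy <;> omega
  rcases key _ _ rfl rfl with ⟨h1, h2⟩ | ⟨h1, h2⟩ | ⟨h1, h2, h3⟩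
  · unfold nexts; rw [if_pos h1]; simpa using h2
  · unfold nexts; rw [if_neg (by omega), if_pos h1]; simpa using h2
  · unfold nexts; rw [if_neg h1, if_neg h2]; simpa using h3

theorem cls_prev (a m r : ℕ) (ha : 2 ≤ a) (hr : r < a + 4 * m) :
    cls a (if r = 0 then a + 4 * m - 1 else r - 1) ∈ prevs a (cls a r) := by
  have key : ∀ x y, y = cls a r → x = cls a (if r = 0 then a + 4 * m - 1 else r - 1) →
      (y = 0 ∧ (x = a - 1 ∨ x = a + 3)) ∨ (y = a ∧ (x = a - 1 ∨ x = a + 3)) ∨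
      (y ≠ 0 ∧ y ≠ a ∧ x = y - 1) := by
    intro x y hy hx
    unfold cls at hx hy
    split_ifs at hx hy <;> omega
  rcases key _ _ rfl rfl with ⟨h1, h2⟩ | ⟨h1, h2⟩ | ⟨h1, h2, h3⟩
  · unfold prevs; rw [if_pos h1]; simpa using h2
  · unfold prevs; rw [if_neg (by omega), if_pos h1]; simpa using h2
  · unfold prevs; rw [if_neg h1, if_neg h2]; simpa using h3

theorem cls_right (a b m p r j : ℕ) (ha : 2 ≤ a) (hb : 2 ≤ b) (hr : r < a + 4 * m)
    (hj : j < b + 4 * p) :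
    (if j + 1 = b + 4 * p then (cls a (if r + 1 = a + 4 * m then 0 else r + 1), cls b 0)
      else (cls a r, cls b (j + 1))) ∈ rights a b (cls a r) (cls b j) := by
  have h0 : cls b 0 = 0 := by unfold cls; rw [if_pos (by omega)]
  have hn := cls_next a m r ha hr
  generalize (if r + 1 = a + 4 * m then 0 else r + 1) = r' at hn ⊢
  split_ifs with h
  · have key : cls b j = b + 3 ∨ cls b j + 1 = b := by unfold cls; split_ifs <;> omega
    rw [h0]
    unfold rights
    rcases key with h1 | h1
    · rw [if_pos h1]
      exact List.mem_cons_of_mem _ (List.mem_map.2 ⟨_, hn, rfl⟩)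
    · rw [if_neg (by omega), if_pos h1]
      exact List.mem_cons_of_mem _ (List.mem_map.2 ⟨_, hn, rfl⟩)
  · have key : ∀ x y, y = cls b j → x = cls b (j + 1) →
      (y = b + 3 ∧ x = b) ∨ (y + 1 = b ∧ x = b) ∨ (y ≠ b + 3 ∧ y + 1 ≠ b ∧ x = y + 1) := by
      intro x y hy hx
      unfold cls at hx hy
      split_ifs at hx hy <;> omega
    rcases key _ _ rfl rfl with ⟨h1, h2⟩ | ⟨h1, h2⟩ | ⟨h1, h2, h3⟩
    · unfold rights; rw [if_pos h1, h2]; simp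
    · unfold rights; rw [if_neg (by omega), if_pos h1, h2]; simp
    · unfold rights; rw [if_neg h1, if_neg h2, h3]; simp

theorem cls_left (a b m p r j : ℕ) (ha : 2 ≤ a) (hb : 2 ≤ b) (hr : r < a + 4 * m)
    (hj : j < b + 4 * p) :
    (if j = 0 then (cls a (if r = 0 then a + 4 * m - 1 else r - 1), cls b (b + 4 * p - 1))
      else (cls a r, cls b (j - 1))) ∈ lefts a b (cls a r) (cls b j) := by
  have hn := cls_prev a m r ha hr
  generalize (if r = 0 then a + 4 * m - 1 else r - 1) = r' at hn ⊢
  by_cases h : j = 0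
  · rw [if_pos h]
    have h0 : cls b j = 0 := by unfold cls; rw [if_pos (by omega)]; exact h
    have key : cls b (b + 4 * p - 1) = b - 1 ∨ cls b (b + 4 * p - 1) = b + 3 := by
      unfold cls; split_ifs <;> omega
    unfold lefts
    rw [if_pos h0, List.mem_flatMap]
    refine ⟨_, hn, ?_⟩
    rcases key with h1 | h1 <;> rw [h1] <;> simp
  · rw [if_neg h]
    have key : ∀ x y, y = cls b j → x = cls b (j - 1) →
      (y = b ∧ (x = b - 1 ∨ x = b + 3)) ∨ (y ≠ 0 ∧ y ≠ b ∧ x = y - 1) := by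
      intro x y hy hx
      unfold cls at hx hy
      split_ifs at hx hy <;> omega
    rcases key _ _ rfl rfl with ⟨h1, h2⟩ | ⟨h1, h2, h3⟩
    · unfold lefts
      rw [if_neg (by omega), if_pos h1]
      rcases h2 with h2 | h2 <;> rw [h2] <;> simp
    · unfold lefts; rw [if_neg h1, if_neg h2, h3]; simp

theorem check_spec {T : List (List ℕ)} {a b : ℕ} (h : check T a b = true) :
    ∀ x < a + 4, ∀ y < b + 4,
      (∀ l ∈ lefts a b x y, ∀ r ∈ rights a b x y,
        cA T x y = true ∨ cB T x y = true ∨ cA T l.1 l.2 = true ∨ cA T r.1 r.2 = true) ∧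
      (∀ l ∈ prevs a x, ∀ r ∈ nexts a x,
        cB T x y = true ∨ cA T x y = true ∨ cB T l y = true ∨ cB T r y = true) := by
  intro x hx y hy
  unfold check at h
  have h1 := List.all_eq_true.1 (List.all_eq_true.1 h x (List.mem_range.2 hx)) y
    (List.mem_range.2 hy)
  rw [Bool.and_eq_true] at h1
  refine ⟨fun l hl r hr => ?_, fun l hl r hr => ?_⟩
  · have := List.all_eq_true.1 (List.all_eq_true.1 h1.1 l hl) r hr
    simpa [or_assoc] using this
  · have := List.all_eq_true.1 (List.all_eq_true.1 h1.2 l hl) r hr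
    simpa [or_assoc] using this

/-- The chosen cells. -/
def cells (f : ℕ → ℕ → Bool) (a b m p : ℕ) : Finset (ℕ × ℕ) :=
  ((Finset.range (a + 4 * m)) ×ˢ (Finset.range (b + 4 * p))).filter
    (fun q => f (cls a q.1) (cls b q.2) = true)

open Classical in
/-- The dominating set. -/
noncomputable def domSet (T : List (List ℕ)) (a b m p n : ℕ) : Finset (ZMod n ⊕ ZMod n) :=
  (cells (cA T) a b m p).image
      (fun q => Sum.inl ((q.1 * (b + 4 * p) + q.2 : ℕ) : ZMod n)) ∪
    (cells (cB T) a b m p).image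
      (fun q => Sum.inr ((q.1 * (b + 4 * p) + q.2 : ℕ) : ZMod n))

theorem card_cells (f : ℕ → ℕ → Bool) (a b m p : ℕ) :
    (cells f a b m p).card = lin a m (fun x => lin b p (fun y => (f x y).toNat)) := by
  unfold cells
  rw [Finset.card_filter, Finset.sum_product]
  rw [← sum_cls]
  refine Finset.sum_congr rfl fun r _ => ?_
  rw [← sum_cls]
  refine Finset.sum_congr rfl fun j _ => ?_
  cases f (cls a r) (cls b j) <;> simp

theorem key_bound (T : List (List ℕ)) (a b m p : ℕ) (ha : 2 ≤ a) (hb : 2 ≤ b)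
    (hT : check T a b = true) :
    gamma (petersen ((a + 4 * m) * (b + 4 * p)) (b + 4 * p)) ≤
      lin a m (fun x => lin b p (fun y => (cA T x y).toNat)) +
      lin a m (fun x => lin b p (fun y => (cB T x y).toNat)) := by
  classical
  have hspec := check_spec hT
  generalize hk : b + 4 * p = k
  generalize hc : a + 4 * m = c
  have hk0 : 0 < k := by omega
  have hc0 : 0 < c := by omega
  have hn : c * k ≠ 0 := by positivity
  haveI : NeZero (c * k) := ⟨hn⟩
  have mA : ∀ r j, r < c → j < k → cA T (cls a r) (cls b j) = true →
      (Sum.inl ((r * k + j : ℕ) : ZMod (c * k))) ∈ domSet T a b m p (c * k) := by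
    intro r j hr hj h
    refine Finset.mem_union_left _ (Finset.mem_image.2 ⟨(r, j), ?_, by rw [hk]⟩)
    simp [cells, hk, hc, hr, hj, h]
  have mB : ∀ r j, r < c → j < k → cB T (cls a r) (cls b j) = true →
      (Sum.inr ((r * k + j : ℕ) : ZMod (c * k))) ∈ domSet T a b m p (c * k) := by
    intro r j hr hj h
    refine Finset.mem_union_right _ (Finset.mem_image.2 ⟨(r, j), ?_, by rw [hk]⟩)
    simp [cells, hk, hc, hr, hj, h]
  have adj : ∀ u v : ZMod (c * k) ⊕ ZMod (c * k), u ∈ domSet T a b m p (c * k) →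
      (u ≠ v → (petersen (c * k) k).Adj u v) →
      v ∈ (↑(domSet T a b m p (c * k)) : Set (ZMod (c * k) ⊕ ZMod (c * k))) ∨
        ∃ u ∈ (↑(domSet T a b m p (c * k)) : Set (ZMod (c * k) ⊕ ZMod (c * k))),
          (petersen (c * k) k).Adj u v := by
    intro u v hu h
    by_cases e : u = v
    · left; rw [← e]; exact hu
    · right; exact ⟨u, hu, h e⟩
  have hck : ((c * k : ℕ) : ZMod (c * k)) = 0 := ZMod.natCast_self _
  -- vertical neighbours
  have up : ∀ r j, r < c → (((if r + 1 = c then 0 else r + 1) * k + j : ℕ) : ZMod (c * k)) =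
      ((r * k + j : ℕ) : ZMod (c * k)) + (k : ZMod (c * k)) := by
    intro r j hr
    split_ifs with h
    · have e : r * k + j + k = c * k + j := by rw [← h]; ring
      rw [← Nat.cast_add, e, Nat.cast_add (c * k), hck]; simp
    · push_cast; ring
  have down : ∀ r j, r < c → (((if r = 0 then c - 1 else r - 1) * k + j : ℕ) : ZMod (c * k)) +
      (k : ZMod (c * k)) = ((r * k + j : ℕ) : ZMod (c * k)) := by
    intro r j hr
    rw [← up _ j (by split_ifs <;> omega)]
    congr 3
    split_ifs <;> omega
  have dom : IsDominating (petersen (c * k) k) ↑(domSet T a b m p (c * k)) := by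
    have main : ∀ x : ZMod (c * k), ∃ r j, r < c ∧ j < k ∧
        x = ((r * k + j : ℕ) : ZMod (c * k)) := by
      intro x
      refine ⟨x.val / k, x.val % k, ?_, Nat.mod_lt _ hk0, ?_⟩
      · exact (Nat.div_lt_iff_lt_mul hk0).2 (ZMod.val_lt x)
      · rw [Nat.div_add_mod']; simp
    rintro (x | x)
    · obtain ⟨r, j, hr, hj, rfl⟩ := main x
      have h1 := (hspec _ (cls_lt a r) _ (cls_lt b j)).1 _
        (cls_left a b m p r j ha hb (by omega) (by omega)) _
        (cls_right a b m p r j ha hb (by omega) (by omega))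
      rw [hk, hc] at h1
      rcases h1 with h1 | h1 | h1 | h1
      · exact Or.inl (mA r j hr hj h1)
      · refine adj _ _ (mB r j hr hj h1) fun e => ?_
        exact (SimpleGraph.fromRel_adj _ _ _).2 ⟨e, Or.inr rfl⟩
      · by_cases h : j = 0
        · simp only [if_pos h] at h1
          refine adj _ _ (mA _ _ (by split_ifs <;> omega) (by omega) h1) fun e => ?_
          refine (SimpleGraph.fromRel_adj _ _ _).2 ⟨e, Or.inl ?_⟩
          show _ = _
          rw [← down r j hr, h]
          obtain ⟨k', rfl⟩ : ∃ k', k = k' + 1 := ⟨k - 1, by omega⟩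
          push_cast [Nat.add_sub_cancel]
          ring
        · simp only [if_neg h] at h1
          refine adj _ _ (mA _ _ hr (by omega) h1) fun e => ?_
          refine (SimpleGraph.fromRel_adj _ _ _).2 ⟨e, Or.inl ?_⟩
          show _ = _
          obtain ⟨j', rfl⟩ : ∃ j', j = j' + 1 := ⟨j - 1, by omega⟩
          push_cast [Nat.add_sub_cancel]
          ring
      · by_cases h : j + 1 = k
        · simp only [if_pos h] at h1
          refine adj _ _ (mA _ _ (by split_ifs <;> omega) (by omega) h1) fun e => ?_
          refine (SimpleGraph.fromRel_adj _ _ _).2 ⟨e, Or.inr ?_⟩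
          show _ = _
          rw [up r 0 hr]
          have hk' : (k : ZMod (c * k)) = (j : ZMod (c * k)) + 1 := by
            have := congrArg (Nat.cast : ℕ → ZMod (c * k)) h
            rw [← this]; push_cast; ring
          rw [Nat.cast_add, Nat.cast_add, hk']
          push_cast
          ring
        · simp only [if_neg h] at h1
          refine adj _ _ (mA _ _ hr (by omega) h1) fun e => ?_
          refine (SimpleGraph.fromRel_adj _ _ _).2 ⟨e, Or.inr ?_⟩
          show _ = _
          push_cast
          ring
    · obtain ⟨r, j, hr, hj, rfl⟩ := main x
      have h1 := (hspec _ (cls_lt a r) _ (cls_lt b j)).2 _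
        (cls_prev a m r ha (by omega)) _ (cls_next a m r ha (by omega))
      rw [hc] at h1
      rcases h1 with h1 | h1 | h1 | h1
      · exact Or.inl (mB r j hr hj h1)
      · refine adj _ _ (mA r j hr hj h1) fun e => ?_
        exact (SimpleGraph.fromRel_adj _ _ _).2 ⟨e, Or.inl rfl⟩
      · refine adj _ _ (mB _ _ (by split_ifs <;> omega) hj h1) fun e => ?_
        refine (SimpleGraph.fromRel_adj _ _ _).2 ⟨e, Or.inl ?_⟩
        exact (down r j hr).symm
      · refine adj _ _ (mB _ _ (by split_ifs <;> omega) hj h1) fun e => ?_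
        refine (SimpleGraph.fromRel_adj _ _ _).2 ⟨e, Or.inr ?_⟩
        exact up r j hr
  have hcard : (domSet T a b m p (c * k)).card ≤
      (cells (cA T) a b m p).card + (cells (cB T) a b m p).card :=
    (Finset.card_union_le _ _).trans
      (Nat.add_le_add Finset.card_image_le Finset.card_image_le)
  rw [card_cells, card_cells] at hcard
  refine le_trans ?_ hcard
  unfold gamma
  exact Nat.sInf_le ⟨_, dom, rfl⟩

def tab51 : List (List ℕ) :=
  [[2, 1, 2, 2, 0, 3, 0, 2],
   [0, 1, 0, 0, 1, 0, 2, 0],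
   [1, 0, 0, 1, 1, 0, 0, 1],
   [1, 2, 2, 1, 0, 2, 0, 1],
   [0, 0, 1, 0, 2, 0, 3, 0],
   [2, 1, 0, 2, 0, 1, 0, 2],
   [1, 0, 2, 0, 1, 0, 2, 0],
   [1, 2, 0, 1, 0, 2, 0, 1],
   [0, 0, 1, 0, 2, 0, 1, 0]]

def tab52 : List (List ℕ) :=
  [[2, 2, 2, 2, 2, 2, 0, 3, 0, 2],
   [0, 1, 0, 0, 1, 0, 1, 0, 2, 0],
   [1, 2, 0, 1, 2, 0, 1, 1, 0, 0],
   [1, 0, 2, 1, 0, 2, 0, 1, 0, 2],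
   [0, 1, 0, 0, 1, 0, 2, 0, 3, 0],
   [2, 0, 1, 2, 0, 1, 0, 2, 0, 1],
   [0, 2, 0, 1, 2, 0, 1, 0, 2, 0],
   [1, 0, 2, 1, 0, 2, 0, 1, 0, 2],
   [0, 1, 0, 0, 1, 0, 2, 0, 1, 0]]

def tab61 : List (List ℕ) :=
  [[0, 2, 2, 2, 2, 0, 1, 2],
   [2, 0, 1, 0, 2, 0, 1, 0],
   [0, 1, 1, 0, 2, 2, 1, 0],
   [2, 1, 0, 2, 0, 1, 0, 2],
   [0, 1, 2, 0, 1, 0, 2, 0],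
   [1, 0, 0, 1, 0, 2, 0, 1],
   [0, 2, 1, 0, 2, 0, 1, 0],
   [2, 1, 0, 2, 0, 1, 0, 2],
   [0, 1, 2, 0, 1, 0, 2, 0],
   [1, 0, 0, 1, 0, 2, 0, 1]]

def tab62 : List (List ℕ) :=
  [[1, 0, 2, 1, 0, 2, 0, 1, 0, 2],
   [1, 0, 0, 1, 2, 0, 3, 0, 2, 0],
   [1, 2, 1, 0, 0, 1, 0, 2, 0, 1],
   [0, 0, 1, 2, 0, 1, 2, 0, 1, 0],
   [2, 0, 1, 0, 2, 1, 0, 2, 0, 3],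
   [0, 2, 0, 1, 0, 1, 1, 0, 2, 0],
   [1, 0, 2, 0, 1, 2, 0, 1, 0, 2],
   [0, 1, 0, 2, 1, 0, 2, 0, 1, 0],
   [2, 0, 1, 0, 2, 1, 0, 2, 0, 1],
   [0, 2, 0, 1, 0, 0, 1, 0, 2, 0]]


/-- A `lin` of `lin` is bilinear in the repetition numbers. -/
theorem lin_lin (a b m p : ℕ) (f : ℕ → ℕ → ℕ) :
    lin a m (fun x => lin b p (f x)) =
      lin a 0 (fun x => lin b 0 (f x)) +
      p * (((List.range a).map (fun x => f x b + f x (b + 1) + f x (b + 2) + f x (b + 3))).sum) +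
      m * (lin b 0 (f a) + lin b 0 (f (a + 1)) + lin b 0 (f (a + 2)) + lin b 0 (f (a + 3))) +
      m * p * ((f a b + f a (b + 1) + f a (b + 2) + f a (b + 3)) +
        (f (a + 1) b + f (a + 1) (b + 1) + f (a + 1) (b + 2) + f (a + 1) (b + 3)) +
        (f (a + 2) b + f (a + 2) (b + 1) + f (a + 2) (b + 2) + f (a + 2) (b + 3)) +
        (f (a + 3) b + f (a + 3) (b + 1) + f (a + 3) (b + 2) + f (a + 3) (b + 3))) := by
  unfold lin
  rw [List.sum_map_add, List.sum_map_mul_left]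
  simp only [Nat.zero_mul, Nat.add_zero]
  ring

theorem petersen_upper_c12mod4_keven (c k : ℕ) (hc : 3 ≤ c)
    (hc4 : c % 4 = 1 ∨ c % 4 = 2) (hk : 4 ≤ k) (hkeven : k % 2 = 0) :
    gamma (petersen (c * k) k) ≤ c * k / 2 + k / 2 - 1 + c / 4 := by
  have hk4 : (∃ p, k = 4 + 4 * p) ∨ (∃ p, k = 6 + 4 * p) := by
    rcases (show k % 4 = 0 ∨ k % 4 = 2 by omega) with h | h
    · exact Or.inl ⟨k / 4 - 1, by omega⟩
    · exact Or.inr ⟨k / 4 - 1, by omega⟩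
  have hc5 : (∃ m, c = 5 + 4 * m) ∨ (∃ m, c = 6 + 4 * m) := by
    rcases hc4 with h | h
    · exact Or.inl ⟨c / 4 - 1, by omega⟩
    · exact Or.inr ⟨c / 4 - 1, by omega⟩
  rcases hc5 with ⟨m, rfl⟩ | ⟨m, rfl⟩ <;> rcases hk4 with ⟨p, rfl⟩ | ⟨p, rfl⟩
  · have h := key_bound tab51 5 4 m p (by norm_num) (by norm_num) (by decide)
    refine h.trans ?_
    rw [lin_lin, lin_lin]
    simp [lin, cA, cB, ent, tab51, List.range_succ]
    ring_nf
    generalize m * p = z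
    omega
  · have h := key_bound tab52 5 6 m p (by norm_num) (by norm_num) (by decide)
    refine h.trans ?_
    rw [lin_lin, lin_lin]
    simp [lin, cA, cB, ent, tab52, List.range_succ]
    ring_nf
    generalize m * p = z
    omega
  · have h := key_bound tab61 6 4 m p (by norm_num) (by norm_num) (by decide)
    refine h.trans ?_
    rw [lin_lin, lin_lin]
    simp [lin, cA, cB, ent, tab61, List.range_succ]
    ring_nf
    generalize m * p = z
    omega
  · have h := key_bound tab62 6 6 m p (by norm_num) (by norm_num) (by decide)
    refine h.trans ?_
    rw [lin_lin, lin_lin]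
    simp [lin, cA, cB, ent, tab62, List.range_succ]
    ring_nf
    generalize m * p = z
    omega
end

section
/- For every k ≥ 1, the domination number of the generalized Petersen graph P(5k,k) equals 3k. -/
open SimpleGraph

/-! ### Lower bound: a potential on pairs of consecutive blocks -/

/-- `c ⊇ {y, y+2, y+3}` for `y` = first position. -/
def hasTri (c0 c1 c2 c3 c4 : Bool) : Bool :=
  (c0 && c2 && c3) || (c1 && c3 && c4) || (c2 && c4 && c0) || (c3 && c0 && c1) || (c4 && c1 && c2)

/-- Does the rotated pair `(b, c)` have potential at most `-1` (with `b` nonempty)? -/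
def neg1 (b0 b1 b2 b3 b4 c0 c1 c2 c3 c4 : Bool) : Bool :=
  (b0 && !b1 && !b2 && !b3 && !b4 && (c1 || c2) && (c3 || c4))
  || (b0 && b1 && !b2 && !b3 && !b4 && c2 && c4)
  || (b0 && b1 && !b2 && b3 && !b4 && c2 && c4)

/-- The potential of a pair of consecutive outer blocks, shifted to take values 0, 1, 2. -/
def psi (b0 b1 b2 b3 b4 c0 c1 c2 c3 c4 : Bool) : ℕ :=
  if (b0 || b1 || b2 || b3 || b4) = false then
    (if hasTri c0 c1 c2 c3 c4 = true then 0 else 1)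
  else if (neg1 b0 b1 b2 b3 b4 c0 c1 c2 c3 c4 || neg1 b1 b2 b3 b4 b0 c1 c2 c3 c4 c0
    || neg1 b2 b3 b4 b0 b1 c2 c3 c4 c0 c1 || neg1 b3 b4 b0 b1 b2 c3 c4 c0 c1 c2
    || neg1 b4 b0 b1 b2 b3 c4 c0 c1 c2 c3) = true then 1 else 2

theorem psi_le (b0 b1 b2 b3 b4 c0 c1 c2 c3 c4 : Bool) :
    psi b0 b1 b2 b3 b4 c0 c1 c2 c3 c4 ≤ 2 := by
  unfold psi
  split_ifs <;> omega

/-- Number of `true`s. -/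
def cnt (b0 b1 b2 b3 b4 : Bool) : ℕ :=
  b0.toNat + b1.toNat + b2.toNat + b3.toNat + b4.toNat

theorem psi_step_aux : ∀ b0 b1 b2 b3 b4 d0 d1 d2 d3 d4 : Bool,
    cnt b0 b1 b2 b3 b4 + cnt d0 d1 d2 d3 d4 ≤ 4 →
    (b0 || d0 || d1 || d4) = true → (b1 || d1 || d2 || d0) = true →
    (b2 || d2 || d3 || d1) = true → (b3 || d3 || d4 || d2) = true →
    (b4 || d4 || d0 || d3) = true →
    ∀ a0 a1 a2 a3 a4 : Bool,
    psi a0 a1 a2 a3 a4 b0 b1 b2 b3 b4 + (cnt b0 b1 b2 b3 b4 + cnt d0 d1 d2 d3 d4) ≤ 4 →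
    ∀ c0 c1 c2 c3 c4 : Bool,
    (b0 || d0 || a0 || c0) = true → (b1 || d1 || a1 || c1) = true →
    (b2 || d2 || a2 || c2) = true → (b3 || d3 || a3 || c3) = true →
    (b4 || d4 || a4 || c4) = true →
    psi b0 b1 b2 b3 b4 c0 c1 c2 c3 c4 + 3 ≤
      psi a0 a1 a2 a3 a4 b0 b1 b2 b3 b4 + (cnt b0 b1 b2 b3 b4 + cnt d0 d1 d2 d3 d4) := by
  decide +kernel

theorem psi_step (a0 a1 a2 a3 a4 b0 b1 b2 b3 b4 c0 c1 c2 c3 c4 d0 d1 d2 d3 d4 : Bool)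
    (i0 : (b0 || d0 || d1 || d4) = true) (i1 : (b1 || d1 || d2 || d0) = true)
    (i2 : (b2 || d2 || d3 || d1) = true) (i3 : (b3 || d3 || d4 || d2) = true)
    (i4 : (b4 || d4 || d0 || d3) = true)
    (o0 : (b0 || d0 || a0 || c0) = true) (o1 : (b1 || d1 || a1 || c1) = true)
    (o2 : (b2 || d2 || a2 || c2) = true) (o3 : (b3 || d3 || a3 || c3) = true)
    (o4 : (b4 || d4 || a4 || c4) = true) :
    psi b0 b1 b2 b3 b4 c0 c1 c2 c3 c4 + 3 ≤
      psi a0 a1 a2 a3 a4 b0 b1 b2 b3 b4 + (cnt b0 b1 b2 b3 b4 + cnt d0 d1 d2 d3 d4) := by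
  have hp := psi_le b0 b1 b2 b3 b4 c0 c1 c2 c3 c4
  by_cases h : psi a0 a1 a2 a3 a4 b0 b1 b2 b3 b4
      + (cnt b0 b1 b2 b3 b4 + cnt d0 d1 d2 d3 d4) ≤ 4
  · exact psi_step_aux b0 b1 b2 b3 b4 d0 d1 d2 d3 d4 (by omega) i0 i1 i2 i3 i4
      a0 a1 a2 a3 a4 h c0 c1 c2 c3 c4 o0 o1 o2 o3 o4
  · omega

theorem adj_inl {n k : ℕ} {x : ZMod n ⊕ ZMod n} {i : ZMod n}
    (h : (petersen n k).Adj x (Sum.inl i)) :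
    x = Sum.inl (i - 1) ∨ x = Sum.inl (i + 1) ∨ x = Sum.inr i := by
  rcases x with j | j
  · simp only [petersen, SimpleGraph.fromRel_adj] at h
    rcases h.2 with h | h
    · left; rw [h]; simp
    · right; left; rw [h]
  · simp only [petersen, SimpleGraph.fromRel_adj] at h
    rcases h.2 with h | h
    · exact h.elim
    · right; right; rw [h]

theorem adj_inr {n k : ℕ} {x : ZMod n ⊕ ZMod n} {i : ZMod n}
    (h : (petersen n k).Adj x (Sum.inr i)) :
    x = Sum.inr (i - k) ∨ x = Sum.inr (i + k) ∨ x = Sum.inl i := by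
  rcases x with j | j
  · simp only [petersen, SimpleGraph.fromRel_adj] at h
    rcases h.2 with h | h
    · right; right; rw [h]
    · exact h.elim
  · simp only [petersen, SimpleGraph.fromRel_adj] at h
    rcases h.2 with h | h
    · left; rw [h]; simp
    · right; left; rw [h]

theorem sum_shift {n : ℕ} [NeZero n] (f : ZMod n → ℕ) (s : ZMod n) :
    ∑ i, f (i + s) = ∑ i, f i :=
  Equiv.sum_comp (Equiv.addRight s) f

theorem lower (k : ℕ) (hk : 1 ≤ k) (S : Finset (ZMod (5 * k) ⊕ ZMod (5 * k)))
    (hS : IsDominating (petersen (5 * k) k) ↑S) : 3 * k ≤ S.card := by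
  classical
  have : NeZero (5 * k) := ⟨by omega⟩
  let o : ZMod (5 * k) → Bool := fun i => decide (Sum.inl i ∈ S)
  let u : ZMod (5 * k) → Bool := fun i => decide (Sum.inr i ∈ S)
  have h5 : (5 : ZMod (5 * k)) * (k : ZMod (5 * k)) = 0 := by
    have := ZMod.natCast_self (5 * k)
    push_cast at this
    exact this
  generalize hK : (k : ZMod (5 * k)) = K at h5
  have hout : ∀ i, (o i || u i || o (i - 1) || o (i + 1)) = true := by
    intro i
    simp only [o, u, Bool.or_eq_true, decide_eq_true_eq]
    rcases hS (Sum.inl i) with h | ⟨x, hx, h⟩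
    · simp only [Finset.mem_coe] at h; tauto
    · rw [Finset.mem_coe] at hx
      rcases adj_inl h with rfl | rfl | rfl <;> tauto
  have hin : ∀ i, (o i || u i || u (i + K) || u (i - K)) = true := by
    intro i
    simp only [o, u, Bool.or_eq_true, decide_eq_true_eq]
    rcases hS (Sum.inr i) with h | ⟨x, hx, h⟩
    · simp only [Finset.mem_coe] at h; tauto
    · rw [Finset.mem_coe] at hx
      rcases adj_inr h with h | h | h <;> rw [h] at hx <;> (try rw [hK] at hx) <;> tauto
  have hcard : S.card = ∑ i, ((o i).toNat + (u i).toNat) := by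
    have : S.card = ∑ x : ZMod (5 * k) ⊕ ZMod (5 * k), if x ∈ S then 1 else 0 := by simp
    rw [this, Fintype.sum_sum_type, Finset.sum_add_distrib]
    congr 1 <;> refine Finset.sum_congr rfl fun i _ => ?_
    · by_cases h : Sum.inl i ∈ S <;> simp [o, h]
    · by_cases h : Sum.inr i ∈ S <;> simp [u, h]
  let P : ZMod (5 * k) → ℕ := fun i =>
    psi (o i) (o (i + K)) (o (i + 2 * K)) (o (i + 3 * K)) (o (i + 4 * K))
      (o (i + 1)) (o (i + K + 1)) (o (i + 2 * K + 1)) (o (i + 3 * K + 1)) (o (i + 4 * K + 1))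
  let w : ZMod (5 * k) → ℕ := fun i => (o i).toNat + (u i).toNat
  have key : ∀ i, P i + 3 ≤ P (i + (-1)) +
      (w i + w (i + K) + w (i + 2 * K) + w (i + 3 * K) + w (i + 4 * K)) := by
    intro i
    have e (m : ZMod (5 * k)) : i - 1 + m = i + m - 1 := by ring
    have e' (m : ZMod (5 * k)) : i + m - 1 + 1 = i + m := by ring
    have step := psi_step (o (i - 1)) (o (i + K - 1)) (o (i + 2 * K - 1)) (o (i + 3 * K - 1))
      (o (i + 4 * K - 1)) (o i) (o (i + K)) (o (i + 2 * K)) (o (i + 3 * K)) (o (i + 4 * K))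
      (o (i + 1)) (o (i + K + 1)) (o (i + 2 * K + 1)) (o (i + 3 * K + 1)) (o (i + 4 * K + 1))
      (u i) (u (i + K)) (u (i + 2 * K)) (u (i + 3 * K)) (u (i + 4 * K))
      (by have := hin i
          rwa [show i - K = i + 4 * K by linear_combination (-1) * h5] at this)
      (by have := hin (i + K)
          rwa [show i + K + K = i + 2 * K by ring, show i + K - K = i by ring] at this)
      (by have := hin (i + 2 * K)
          rwa [show i + 2 * K + K = i + 3 * K by ring,
            show i + 2 * K - K = i + K by ring] at this)
      (by have := hin (i + 3 * K)
          rwa [show i + 3 * K + K = i + 4 * K by ring,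
            show i + 3 * K - K = i + 2 * K by ring] at this)
      (by have := hin (i + 4 * K)
          rwa [show i + 4 * K + K = i by linear_combination h5,
            show i + 4 * K - K = i + 3 * K by ring] at this)
      (hout _) (hout _) (hout _) (hout _) (hout _)
    have hP : P (i + (-1)) = psi (o (i - 1)) (o (i + K - 1)) (o (i + 2 * K - 1))
        (o (i + 3 * K - 1)) (o (i + 4 * K - 1))
        (o i) (o (i + K)) (o (i + 2 * K)) (o (i + 3 * K)) (o (i + 4 * K)) := by
      simp only [P, ← sub_eq_add_neg, sub_add_cancel]
      simp only [e, e']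
    rw [hP]
    simp only [cnt] at step
    simp only [P, w]
    omega
  have hsum := Finset.sum_le_sum fun i (_ : i ∈ Finset.univ) => key i
  simp only [Finset.sum_add_distrib] at hsum
  rw [sum_shift P, sum_shift w, sum_shift w, sum_shift w, sum_shift w] at hsum
  simp only [Finset.sum_const, Finset.card_univ, ZMod.card, smul_eq_mul] at hsum
  have : S.card = ∑ i, w i := hcard
  omega

/-! ### Upper bound -/

/-- Winding function. -/
def wind (k t m : ℕ) : ℕ := m + t * (m / k) + min (m % k) t

theorem wind_add_k (k t m : ℕ) (hk : 1 ≤ k) : wind k t (m + k) = wind k t m + (k + t) := by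
  unfold wind
  rw [Nat.add_div_right m (by omega), Nat.add_mod_right]
  ring

theorem wind_succ (k t m : ℕ) (hk : 1 ≤ k) (ht : t ≤ k) :
    wind k t (m + 1) = wind k t m + 1 ∨ wind k t (m + 1) = wind k t m + 2 := by
  unfold wind
  have hm := Nat.div_add_mod m k
  have hlt := Nat.mod_lt m (show k > 0 by omega)
  set q := m / k
  set r := m % k
  by_cases h : r + 1 < k
  · have h1 : (m + 1) / k = q := by
      rw [← hm, add_assoc, Nat.mul_add_div (by omega), Nat.div_eq_of_lt h]; rfl
    have h2 : (m + 1) % k = r + 1 := by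
      rw [← hm, add_assoc, Nat.mul_add_mod, Nat.mod_eq_of_lt h]
    rw [h1, h2]; omega
  · have hr : r + 1 = k := by omega
    have hm1 : m + 1 = k * (q + 1) := by rw [← hm, mul_add]; omega
    have h1 : (m + 1) / k = q + 1 := by rw [hm1, Nat.mul_div_cancel_left _ (by omega)]
    have h2 : (m + 1) % k = 0 := by rw [hm1, Nat.mul_mod_right]
    rw [h1, h2, mul_add]; omega

theorem wind_period (k t r q : ℕ) (hk : 1 ≤ k) :
    ((wind k t (r + 5 * k * q) : ℕ) : ZMod 5) = (wind k t r : ZMod 5) := by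
  induction q with
  | zero => simp
  | succ q ih =>
    rw [show r + 5 * k * (q + 1) = r + 5 * k * q + k + k + k + k + k by ring]
    simp only [wind_add_k _ _ _ hk]
    push_cast
    rw [ih]
    have : (5 : ZMod 5) = 0 := rfl
    linear_combination ((k : ZMod 5) + t) * this

theorem exists_wind (k : ℕ) (hk : 1 ≤ k) : ∃ (G : ZMod (5 * k) → ZMod 5) (e : ZMod 5),
    (e = 1 ∨ e = 4) ∧ (∀ i, G (i + 1) = G i + 1 ∨ G (i + 1) = G i + 2) ∧
    ∀ i, G (i + k) = G i + e := by
  have : NeZero (5 * k) := ⟨by omega⟩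
  obtain ⟨t, ht, hkt⟩ : ∃ t ≤ k, (k + t) % 5 = 1 ∨ (k + t) % 5 = 4 := by
    have : k % 5 < 5 := Nat.mod_lt _ (by omega)
    by_cases h0 : k % 5 = 0
    · exact ⟨1, by omega, by omega⟩
    by_cases h0 : k % 5 = 2
    · exact ⟨2, by omega, by omega⟩
    by_cases h0 : k % 5 = 3
    · exact ⟨1, by omega, by omega⟩
    · exact ⟨0, by omega, by omega⟩
  have hG : ∀ m : ℕ, ((wind k t (m : ZMod (5 * k)).val : ℕ) : ZMod 5) = (wind k t m : ZMod 5) := by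
    intro m
    rw [ZMod.val_natCast]
    conv_rhs => rw [← Nat.mod_add_div m (5 * k)]
    rw [wind_period _ _ _ _ hk]
  refine ⟨fun i => ((wind k t i.val : ℕ) : ZMod 5), ((k + t : ℕ) : ZMod 5), ?_, ?_, ?_⟩
  · rw [← ZMod.natCast_mod (k + t) 5]
    rcases hkt with h | h <;> rw [h]
    · left; rfl
    · right; rfl
  · intro i
    obtain ⟨m, rfl⟩ := ZMod.natCast_zmod_surjective i
    have := hG (m + 1)
    push_cast at this
    simp only [this, hG m]
    rcases wind_succ k t m hk ht with h | h <;> rw [h] <;> push_cast <;> simp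
  · intro i
    obtain ⟨m, rfl⟩ := ZMod.natCast_zmod_surjective i
    have := hG (m + k)
    push_cast at this
    simp only [this, hG m]
    rw [wind_add_k _ _ _ hk]
    push_cast
    rfl

theorem upper (k : ℕ) (hk : 1 ≤ k) : ∃ S : Finset (ZMod (5 * k) ⊕ ZMod (5 * k)),
    IsDominating (petersen (5 * k) k) ↑S ∧ S.card = 3 * k := by
  classical
  have : NeZero (5 * k) := ⟨by omega⟩
  obtain ⟨G, e, he, h1, hK⟩ := exists_wind k hk
  have hm1 : ∀ i, G (i - 1) = G i - 1 ∨ G (i - 1) = G i - 2 := by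
    intro i
    have := h1 (i - 1)
    rw [sub_add_cancel] at this
    rcases this with h | h <;> rw [h] <;> simp
  have hmK : ∀ i, G (i - k) = G i - e := by
    intro i
    have := hK (i - k)
    rw [sub_add_cancel] at this
    rw [this]; simp
  let S : Finset (ZMod (5 * k) ⊕ ZMod (5 * k)) := Finset.univ.filter fun x =>
    match x with
    | Sum.inl i => G i = 0
    | Sum.inr i => G i ≠ 0 ∧ G (i + 1) ≠ 0 ∧ G (i - 1) ≠ 0
  have memo : ∀ i, Sum.inl i ∈ S ↔ G i = 0 := by intro i; simp [S]
  have memu : ∀ i, Sum.inr i ∈ S ↔ (G i ≠ 0 ∧ G (i + 1) ≠ 0 ∧ G (i - 1) ≠ 0) := by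
    intro i; simp [S]
  have hk1 : (1 : ZMod (5 * k)) ≠ 0 := by
    have : Fact (1 < 5 * k) := ⟨by omega⟩
    exact one_ne_zero
  have e0 : e ≠ 0 := by rcases he with rfl | rfl <;> decide
  have hk0 : (k : ZMod (5 * k)) ≠ 0 := by
    intro h
    have := hK 0
    rw [h, add_zero] at this
    exact e0 (by simpa using this.symm)
  refine ⟨S, ?_, ?_⟩
  · rintro (i | i)
    · by_cases ha : G i = 0
      · left; exact (memo i).2 ha
      right
      by_cases hb : G (i + 1) = 0
      · refine ⟨Sum.inl (i + 1), (memo _).2 hb, ?_⟩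
        simp only [petersen, SimpleGraph.fromRel_adj]
        exact ⟨by simpa using hk1, Or.inr trivial⟩
      by_cases hc : G (i - 1) = 0
      · refine ⟨Sum.inl (i - 1), (memo _).2 hc, ?_⟩
        simp only [petersen, SimpleGraph.fromRel_adj]
        exact ⟨by simpa using hk1, Or.inl (by ring)⟩
      · refine ⟨Sum.inr i, (memu _).2 ⟨ha, hb, hc⟩, ?_⟩
        simp [petersen, SimpleGraph.fromRel_adj]
    · by_cases ha : Sum.inr i ∈ S
      · left; exact ha
      right
      by_cases hb : Sum.inl i ∈ S
      · refine ⟨Sum.inl i, hb, ?_⟩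
        simp [petersen, SimpleGraph.fromRel_adj]
      by_cases hc : Sum.inr (i + (k : ZMod (5 * k))) ∈ S
      · refine ⟨_, hc, ?_⟩
        simp only [petersen, SimpleGraph.fromRel_adj]
        exact ⟨by simpa using hk0, Or.inr trivial⟩
      by_cases hd : Sum.inr (i - (k : ZMod (5 * k))) ∈ S
      · refine ⟨_, hd, ?_⟩
        simp only [petersen, SimpleGraph.fromRel_adj]
        exact ⟨by simpa using hk0, Or.inl (by ring)⟩
      exfalso
      rw [memu] at ha hc hd
      rw [memo] at hb
      rw [show i + (k : ZMod (5 * k)) + 1 = (i + 1) + k by ring,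
        show i + (k : ZMod (5 * k)) - 1 = (i - 1) + k by ring, hK, hK, hK] at hc
      rw [show i - (k : ZMod (5 * k)) + 1 = (i + 1) - k by ring,
        show i - (k : ZMod (5 * k)) - 1 = (i - 1) - k by ring, hmK, hmK, hmK] at hd
      have hp := h1 i
      have hq := hm1 i
      generalize G (i + 1) = y at *
      generalize G (i - 1) = z at *
      generalize G i = x at *
      clear memo memu hK hmK h1 hm1 S
      revert x y z e
      decide
  · let o : ZMod (5 * k) → ℕ := fun i => if G i = 0 then 1 else 0
    let u : ZMod (5 * k) → ℕ := fun i =>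
      if (G i ≠ 0 ∧ G (i + 1) ≠ 0 ∧ G (i - 1) ≠ 0) then 1 else 0
    have hcard : S.card = ∑ i, o i + ∑ i, u i := by
      have : S.card = ∑ x : ZMod (5 * k) ⊕ ZMod (5 * k), if x ∈ S then 1 else 0 := by simp
      rw [this, Fintype.sum_sum_type]
      simp only [memo, memu, o, u]
    have ho : ∀ i, o i + o (i + k) + o (i + k + k) + o (i + k + k + k)
        + o (i + k + k + k + k) = 1 := by
      intro i
      simp only [o, hK]
      generalize G i = x
      revert x
      rcases he with rfl | rfl <;> decide
    have hu : ∀ i, u i + (o i + o (i + 1) + o (i + (-1))) = 1 := by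
      intro i
      simp only [o, u, ← sub_eq_add_neg]
      have hp := h1 i
      have hq := hm1 i
      generalize G (i + 1) = y at *
      generalize G (i - 1) = z at *
      generalize G i = x at *
      clear memo memu hK hmK h1 hm1 S hcard ho o u
      revert x y z
      decide
    have s1 := Finset.sum_congr rfl fun i (_ : i ∈ Finset.univ) => ho i
    have s2 := Finset.sum_congr rfl fun i (_ : i ∈ Finset.univ) => hu i
    simp only [add_assoc] at s1
    simp only [Finset.sum_add_distrib, sum_shift, Finset.sum_const, Finset.card_univ, ZMod.card,
      smul_eq_mul] at s1 s2
    omega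

theorem gamma_P5k (k : ℕ) (hk : 1 ≤ k) : gamma (petersen (5 * k) k) = 3 * k := by
  apply le_antisymm
  · exact Nat.sInf_le (upper k hk)
  · obtain ⟨S, hS, hc⟩ := Nat.sInf_mem (s := {m | ∃ S : Finset (ZMod (5 * k) ⊕ ZMod (5 * k)),
      IsDominating (petersen (5 * k) k) ↑S ∧ S.card = m}) ⟨_, upper k hk⟩
    unfold gamma
    rw [← hc]
    exact lower k hk S hS
end

section
/- For every k ≥ 1 with k ≠ 2, the domination number of the generalized Petersen graph P(6k,k) equals ⌈10k/3⌉; and γ(P(12,2)) = ⌈20/3⌉ + 1 = 8. -/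
open SimpleGraph

namespace P6k

/-! ### Bit masks for columns -/

/-- The 6-bit mask with the given bits. -/
def m6 (x0 x1 x2 x3 x4 x5 : Bool) : ℕ :=
  x0.toNat + 2 * x1.toNat + 4 * x2.toNat + 8 * x3.toNat + 16 * x4.toNat + 32 * x5.toNat

/-- The mask of the first six values of a Boolean sequence. -/
def M (f : ℕ → Bool) : ℕ := m6 (f 0) (f 1) (f 2) (f 3) (f 4) (f 5)

/-- Number of ones in a 6-bit mask. -/
def pc (x : ℕ) : ℕ :=
  x % 2 + x / 2 % 2 + x / 4 % 2 + x / 8 % 2 + x / 16 % 2 + x / 32 % 2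

def rotl (x : ℕ) : ℕ := (2 * x) % 64 + x / 32
def rotr (x : ℕ) : ℕ := x / 2 + 32 * (x % 2)

/-- The inner 6-cycle is dominated (`b` outer vertices, `B` inner vertices). -/
def valid (b B : ℕ) : Bool := (B ||| rotl B ||| rotr B ||| b) == 63

/-- The potential, as a decimal table. -/
def pot (b m : ℕ) : ℕ :=
  (match m with
    | 0 => 1011400111144010111141114444401140114111414441414144444444444
    | 1 => 3013400133344010311343334444503140334131434453434344544454555
    | _ => 3033600333366030333363336666603360336333636663636366666666668) / 10 ^ b % 10

def allB : ℕ → (ℕ → Bool) → Bool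
  | 0, _ => true
  | n + 1, f => f n && allB n f

theorem allB_spec {n : ℕ} {f : ℕ → Bool} (h : allB n f = true) : ∀ i < n, f i = true := by
  induction n with
  | zero => intro i hi; omega
  | succ n ih =>
    simp only [allB, Bool.and_eq_true] at h
    intro i hi
    rcases Nat.lt_succ_iff_lt_or_eq.mp hi with h1 | h1
    · exact ih h.2 i h1
    · subst h1; exact h.1

theorem chk1 : allB 64 (fun b => allB 64 fun B =>
    !(valid b B) || Nat.ble 6 (pc b + pc B) ||
      allB 64 fun a => Nat.ble (pot a (pc b) + 10)
        (3 * (pc b + pc B) + pot b (pc (63 ^^^ (a ||| b ||| B))))) = true := by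
  decide +kernel

theorem chk2 : allB 64 (fun X => allB 64 fun Y =>
    !(valid X Y) || Nat.ble 4 (pc X + pc Y) ||
      allB 64 fun Z => !((X ||| Y ||| Z ||| rotl Z) == 63) ||
        allB 64 fun W => !((Z ||| W ||| X ||| rotr X) == 63) || !(valid Z W) ||
          Nat.ble 8 (pc X + pc Y + pc Z + pc W)) = true := by
  decide +kernel

theorem pot_mono : allB 64 (fun b => Nat.ble (pot b 0) (pot b 1) && Nat.ble (pot b 1) (pot b 2)
    && Nat.ble (pot b 2) 8) = true := by
  decide +kernel

theorem M_lt (f : ℕ → Bool) : M f < 64 := by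
  unfold M
  generalize f 0 = a0, f 1 = a1, f 2 = a2, f 3 = a3, f 4 = a4, f 5 = a5
  revert a0 a1 a2 a3 a4 a5
  decide

theorem pc_M (f : ℕ → Bool) : pc (M f) = (f 0).toNat + (f 1).toNat + (f 2).toNat + (f 3).toNat
    + (f 4).toNat + (f 5).toNat := by
  unfold M
  generalize f 0 = a0, f 1 = a1, f 2 = a2, f 3 = a3, f 4 = a4, f 5 = a5
  revert a0 a1 a2 a3 a4 a5
  decide

theorem pc_not_M (f : ℕ → Bool) : 63 ^^^ M f = M (fun t => !(f t)) := by
  simp only [M]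
  generalize f 0 = a0, f 1 = a1, f 2 = a2, f 3 = a3, f 4 = a4, f 5 = a5
  revert a0 a1 a2 a3 a4 a5
  decide

theorem M_or (f g : ℕ → Bool) : M f ||| M g = M (fun t => f t || g t) := by
  simp only [M]
  generalize f 0 = a0, f 1 = a1, f 2 = a2, f 3 = a3, f 4 = a4, f 5 = a5,
    g 0 = b0, g 1 = b1, g 2 = b2, g 3 = b3, g 4 = b4, g 5 = b5
  revert a0 a1 a2 a3 a4 a5 b0 b1 b2 b3 b4 b5
  decide +kernel

theorem rotr_M (f : ℕ → Bool) (hf : ∀ t, f (t + 6) = f t) : rotr (M f) = M (fun t => f (t + 1)) := by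
  unfold M
  have := hf 0
  simp only [Nat.zero_add, Nat.reduceAdd] at this ⊢
  rw [this]
  generalize f 0 = a0, f 1 = a1, f 2 = a2, f 3 = a3, f 4 = a4, f 5 = a5
  revert a0 a1 a2 a3 a4 a5
  decide

theorem rotl_M (f : ℕ → Bool) (hf : ∀ t, f (t + 6) = f t) : rotl (M f) = M (fun t => f (t + 5)) := by
  unfold M
  have h0 := hf 0
  have h1 := hf 1
  have h2 := hf 2
  have h3 := hf 3
  have h4 := hf 4
  simp only [Nat.zero_add, Nat.reduceAdd] at h0 h1 h2 h3 h4 ⊢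
  rw [h0, h1, h2, h3, h4]
  generalize f 0 = a0, f 1 = a1, f 2 = a2, f 3 = a3, f 4 = a4, f 5 = a5
  revert a0 a1 a2 a3 a4 a5
  decide

theorem M_true (f : ℕ → Bool) (hf : ∀ t, f t = true) : M f = 63 := by
  unfold M
  simp only [hf]
  decide

theorem valid_M (b B : ℕ → Bool) (hB : ∀ t, B (t + 6) = B t)
    (h : ∀ t, (B t || B (t + 5) || B (t + 1) || b t) = true) : valid (M b) (M B) = true := by
  unfold valid
  rw [rotl_M B hB, rotr_M B hB, M_or, M_or, M_or, M_true _ h]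
  rfl

theorem pot_mono' {b m n : ℕ} (hb : b < 64) (h : m ≤ n) : pot b m ≤ pot b n := by
  have H := allB_spec pot_mono b hb
  simp only [Bool.and_eq_true, Nat.ble_eq] at H
  obtain ⟨⟨h1, h2⟩, -⟩ := H
  match m, n, h with
  | 0, 0, _ => exact le_rfl
  | 0, 1, _ => exact h1
  | 0, n + 2, _ => exact h1.trans h2
  | 1, 1, _ => exact le_rfl
  | 1, n + 2, _ => exact h2
  | m + 2, n + 2, _ => exact le_rfl

theorem pot_le {b m : ℕ} (hb : b < 64) : pot b m ≤ 8 := by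
  have H := allB_spec pot_mono b hb
  simp only [Bool.and_eq_true, Nat.ble_eq] at H
  exact (pot_mono' hb (Nat.le_add_right m 2)).trans H.2

theorem key1 (a b B c : ℕ → Bool) (hB : ∀ t, B (t + 6) = B t)
    (h1 : ∀ t, (B t || B (t + 5) || B (t + 1) || b t) = true)
    (h2 : ∀ t, (a t || b t || B t || c t) = true) :
    pot (M a) (pc (M b)) + 10 ≤ 3 * (pc (M b) + pc (M B)) + pot (M b) (pc (M c)) := by
  have H := allB_spec (allB_spec chk1 _ (M_lt b)) _ (M_lt B)
  rw [valid_M b B hB h1] at H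
  simp only [Bool.not_true, Bool.false_or, Bool.or_eq_true, Nat.ble_eq] at H
  rcases H with H | H
  · have := pot_le (b := M a) (m := pc (M b)) (M_lt a)
    omega
  · have H := allB_spec H _ (M_lt a)
    rw [Nat.ble_eq, M_or, M_or, pc_not_M] at H
    have : pc (M fun t => !(a t || b t || B t)) ≤ pc (M c) := by
      rw [pc_M, pc_M]
      have hle : ∀ t, (!(a t || b t || B t)).toNat ≤ (c t).toNat := by
        intro t
        have := h2 t
        revert this
        cases (a t || b t || B t) <;> cases c t <;> simp
      have e0 := hle 0
      have e1 := hle 1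
      have e2 := hle 2
      have e3 := hle 3
      have e4 := hle 4
      have e5 := hle 5
      omega
    have := pot_mono' (M_lt b) this
    omega

theorem key2 (X Y Z W : ℕ → Bool) (hX : ∀ t, X (t + 6) = X t) (hY : ∀ t, Y (t + 6) = Y t)
    (hZ : ∀ t, Z (t + 6) = Z t) (hW : ∀ t, W (t + 6) = W t)
    (h1 : ∀ t, (Y t || Y (t + 5) || Y (t + 1) || X t) = true)
    (h2 : ∀ t, (W t || W (t + 5) || W (t + 1) || Z t) = true)
    (h3 : ∀ t, (X t || Y t || Z t || Z (t + 5)) = true)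
    (h4 : ∀ t, (Z t || W t || X t || X (t + 1)) = true)
    (hs : pc (M X) + pc (M Y) ≤ 3) :
    8 ≤ pc (M X) + pc (M Y) + pc (M Z) + pc (M W) := by
  have H := allB_spec (allB_spec chk2 _ (M_lt X)) _ (M_lt Y)
  rw [valid_M X Y hY h1] at H
  simp only [Bool.not_true, Bool.false_or, Bool.or_eq_true, Nat.ble_eq] at H
  rcases H with H | H
  · omega
  · have H := allB_spec H _ (M_lt Z)
    rw [rotl_M Z hZ, M_or, M_or, M_or, M_true _ h3] at H
    simp only [BEq.rfl, Bool.not_true, Bool.false_or] at H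
    have H := allB_spec H _ (M_lt W)
    rw [rotr_M X hX, M_or, M_or, M_or, M_true _ h4, valid_M Z W hW h2] at H
    simpa using H

/-! ### Lower bound -/

section lower
variable {k : ℕ}

/-- Outer part of the column through `i`. -/
noncomputable def cX (S : Finset (ZMod (6 * k) ⊕ ZMod (6 * k))) (i : ZMod (6 * k)) (t : ℕ) : Bool :=
  open Classical in decide (Sum.inl (i + t * k) ∈ S)

/-- Inner part of the column through `i`. -/
noncomputable def cY (S : Finset (ZMod (6 * k) ⊕ ZMod (6 * k))) (i : ZMod (6 * k)) (t : ℕ) : Bool :=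
  open Classical in decide (Sum.inr (i + t * k) ∈ S)

theorem six_k : (6 : ZMod (6 * k)) * k = 0 := by
  have := ZMod.natCast_self (6 * k)
  push_cast at this
  exact this

theorem shift_six (i : ZMod (6 * k)) (t : ℕ) : i + ((t + 6 : ℕ) : ZMod (6 * k)) * k = i + t * k := by
  push_cast
  linear_combination (six_k (k := k))

theorem cX_per (S : Finset (ZMod (6 * k) ⊕ ZMod (6 * k))) (i : ZMod (6 * k)) (t : ℕ) :
    cX S i (t + 6) = cX S i t := by
  unfold cX; rw [shift_six]

theorem cY_per (S : Finset (ZMod (6 * k) ⊕ ZMod (6 * k))) (i : ZMod (6 * k)) (t : ℕ) :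
    cY S i (t + 6) = cY S i t := by
  unfold cY; rw [shift_six]

theorem dom_inl {S : Finset (ZMod (6 * k) ⊕ ZMod (6 * k))}
    (h : IsDominating (petersen (6 * k) k) ↑S) (i : ZMod (6 * k)) :
    Sum.inl (i - 1) ∈ S ∨ Sum.inl i ∈ S ∨ Sum.inr i ∈ S ∨ Sum.inl (i + 1) ∈ S := by
  rcases h (Sum.inl i) with h | ⟨u, hu, hadj⟩
  · exact Or.inr (Or.inl h)
  · rcases u with j | j
    · simp only [petersen, SimpleGraph.fromRel_adj] at hadj
      rcases hadj.2 with h | h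
      · left
        have : i - 1 = j := by rw [h]; ring
        rw [this]; exact hu
      · right; right; right
        rw [← h]; exact hu
    · simp only [petersen, SimpleGraph.fromRel_adj] at hadj
      rcases hadj.2 with h | h
      · exact h.elim
      · right; right; left
        rw [← h]; exact hu

theorem dom_inr {S : Finset (ZMod (6 * k) ⊕ ZMod (6 * k))}
    (h : IsDominating (petersen (6 * k) k) ↑S) (i : ZMod (6 * k)) :
    Sum.inr (i - k) ∈ S ∨ Sum.inr i ∈ S ∨ Sum.inl i ∈ S ∨ Sum.inr (i + k) ∈ S := by
  rcases h (Sum.inr i) with h | ⟨u, hu, hadj⟩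
  · exact Or.inr (Or.inl h)
  · rcases u with j | j
    · simp only [petersen, SimpleGraph.fromRel_adj] at hadj
      rcases hadj.2 with h | h
      · right; right; left
        rw [h]; exact hu
      · exact h.elim
    · simp only [petersen, SimpleGraph.fromRel_adj] at hadj
      rcases hadj.2 with h | h
      · left
        have : i - k = j := by rw [h]; ring
        rw [this]; exact hu
      · right; right; right
        rw [← h]; exact hu

theorem col_outer {S : Finset (ZMod (6 * k) ⊕ ZMod (6 * k))}
    (h : IsDominating (petersen (6 * k) k) ↑S) (i : ZMod (6 * k)) (t : ℕ) :
    (cX S i t || cX S (i + 1) t || cY S (i + 1) t || cX S (i + 1 + 1) t) = true := by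
  have H := dom_inl h (i + 1 + t * k)
  have e1 : i + 1 + t * k - 1 = i + t * k := by ring
  have e2 : i + 1 + t * k + 1 = i + 1 + 1 + t * k := by ring
  rw [e1, e2] at H
  simp only [cX, cY, Bool.or_eq_true, decide_eq_true_eq]
  tauto

theorem col_inner {S : Finset (ZMod (6 * k) ⊕ ZMod (6 * k))}
    (h : IsDominating (petersen (6 * k) k) ↑S) (i : ZMod (6 * k)) (t : ℕ) :
    (cY S i t || cY S i (t + 5) || cY S i (t + 1) || cX S i t) = true := by
  have H := dom_inr h (i + t * k)
  have e1 : i + t * k - k = i + ((t + 5 : ℕ) : ZMod (6 * k)) * k := by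
    push_cast
    linear_combination -(six_k (k := k))
  have e2 : i + t * k + k = i + ((t + 1 : ℕ) : ZMod (6 * k)) * k := by push_cast; ring
  rw [e1, e2] at H
  simp only [cX, cY, Bool.or_eq_true, decide_eq_true_eq]
  tauto

/-- Size of the column through `i`. -/
noncomputable def cs (S : Finset (ZMod (6 * k) ⊕ ZMod (6 * k))) (i : ZMod (6 * k)) : ℕ :=
  pc (M (cX S i)) + pc (M (cY S i))

theorem sum_cs [NeZero (6 * k)] (S : Finset (ZMod (6 * k) ⊕ ZMod (6 * k))) :
    ∑ i, cs S i = 6 * S.card := by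
  classical
  have hX : ∀ t, ∑ i, (cX S i t).toNat = ∑ i, (cX S i 0).toNat := by
    intro t
    rw [← Equiv.sum_comp (Equiv.addRight ((t : ZMod (6 * k)) * k)) (fun i => (cX S i 0).toNat)]
    simp [cX]
  have hY : ∀ t, ∑ i, (cY S i t).toNat = ∑ i, (cY S i 0).toNat := by
    intro t
    rw [← Equiv.sum_comp (Equiv.addRight ((t : ZMod (6 * k)) * k)) (fun i => (cY S i 0).toNat)]
    simp [cY]
  have hc : S.card = ∑ i, (cX S i 0).toNat + ∑ i, (cY S i 0).toNat := by
    have : S.card = ∑ v, (decide (v ∈ S)).toNat := by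
      simp [Bool.toNat, Bool.cond_decide]
    rw [this, Fintype.sum_sum_type]
    simp [cX, cY]
  simp only [cs, pc_M, Finset.sum_add_distrib]
  rw [hX 1, hX 2, hX 3, hX 4, hX 5, hY 1, hY 2, hY 3, hY 4, hY 5, hc]
  ring

theorem lower {S : Finset (ZMod (6 * k) ⊕ ZMod (6 * k))} (hk : 1 ≤ k)
    (h : IsDominating (petersen (6 * k) k) ↑S) : 10 * k ≤ 3 * S.card := by
  have : NeZero (6 * k) := ⟨by omega⟩
  have key : ∀ i, pot (M (cX S i)) (pc (M (cX S (i + 1)))) + 10 ≤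
      3 * cs S (i + 1) + pot (M (cX S (i + 1))) (pc (M (cX S (i + 1 + 1)))) := by
    intro i
    exact key1 _ _ _ _ (cY_per S (i + 1)) (col_inner h (i + 1)) (col_outer h i)
  have H := Finset.sum_le_sum (s := Finset.univ) (fun i _ => key i)
  rw [Finset.sum_add_distrib, Finset.sum_add_distrib, ← Finset.mul_sum] at H
  have e1 := Equiv.sum_comp (Equiv.addRight (1 : ZMod (6 * k))) (cs S)
  have e2 := Equiv.sum_comp (Equiv.addRight (1 : ZMod (6 * k)))
    (fun i => pot (M (cX S i)) (pc (M (cX S (i + 1)))))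
  simp only [Equiv.coe_addRight] at e1 e2
  rw [e1, e2, sum_cs] at H
  simp only [Finset.sum_const, Finset.card_univ, ZMod.card, smul_eq_mul] at H
  omega

theorem lower12 {S : Finset (ZMod (6 * 2) ⊕ ZMod (6 * 2))}
    (h : IsDominating (petersen (6 * 2) 2) ↑S) : 8 ≤ S.card := by
  have sX : ∀ i t, cX S (i + 1 + 1) t = cX S i (t + 1) := by
    intro i t
    have : i + 1 + 1 + (t : ZMod (6 * 2)) * (2 : ℕ)
      = i + ((t + 1 : ℕ) : ZMod (6 * 2)) * (2 : ℕ) := by push_cast; ring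
    unfold cX
    rw [this]
  have sY : ∀ i t, cY S (i + 1 + 1) t = cY S i (t + 1) := by
    intro i t
    have : i + 1 + 1 + (t : ZMod (6 * 2)) * (2 : ℕ)
      = i + ((t + 1 : ℕ) : ZMod (6 * 2)) * (2 : ℕ) := by push_cast; ring
    unfold cY
    rw [this]
  have scs : ∀ i, cs S (i + 1 + 1) = cs S i := by
    intro i
    simp only [cs, pc_M, sX, sY]
    have e1 := cX_per S i 0
    have e2 := cY_per S i 0
    simp only [Nat.zero_add, Nat.reduceAdd] at e1 e2 ⊢
    rw [e1, e2]
    ring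
  have low : ∀ i, cs S i ≤ 3 → 8 ≤ cs S i + cs S (i + 1) := by
    intro i hi
    have := key2 (cX S i) (cY S i) (cX S (i + 1)) (cY S (i + 1)) (cX_per S i) (cY_per S i)
      (cX_per S _) (cY_per S _) (col_inner h i) (col_inner h (i + 1)) ?_ ?_ hi
    · unfold cs; omega
    · intro t
      have H := col_outer h (i - 1) t
      have e : cX S (i - 1) t = cX S (i + 1) (t + 5) := by
        have := sX (i - 1) (t + 5)
        rw [cX_per, sub_add_cancel] at this
        exact this.symm
      rw [e, sub_add_cancel] at H
      revert H
      cases cX S (i + 1) (t + 5) <;> cases cX S i t <;> cases cY S i t <;> cases cX S (i + 1) t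
        <;> simp
    · intro t
      have H := col_outer h i t
      rw [sX] at H
      revert H
      cases cX S (i + 1) t <;> cases cX S i t <;> cases cY S (i + 1) t <;> cases cX S i (t + 1)
        <;> simp
  have all : ∀ i, 8 ≤ cs S i + cs S (i + 1) := by
    intro i
    by_cases h1 : cs S i ≤ 3
    · exact low i h1
    · by_cases h2 : cs S (i + 1) ≤ 3
      · have := low _ h2
        rw [scs] at this
        omega
      · omega
  have H := Finset.sum_le_sum (s := Finset.univ) (fun i _ => all i)
  have : NeZero (6 * 2) := ⟨by omega⟩
  have e1 := Equiv.sum_comp (Equiv.addRight (1 : ZMod (6 * 2))) (cs S)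
  simp only [Equiv.coe_addRight] at e1
  rw [Finset.sum_add_distrib, e1, sum_cs] at H
  simp only [Finset.sum_const, Finset.card_univ, ZMod.card, smul_eq_mul] at H
  omega

end lower

/-! ### Upper bound -/

section upper

/-- Vertices of column `j` prescribed by the masks. -/
def colSet (k : ℕ) (X Y : ℕ → ℕ) (j : ℕ) : Finset (ZMod (6 * k) ⊕ ZMod (6 * k)) :=
  ((Finset.range 6).filter (fun t => (X j).testBit t)).image
      (fun t => Sum.inl ((j + t * k : ℕ) : ZMod (6 * k))) ∪
    ((Finset.range 6).filter (fun t => (Y j).testBit t)).image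
      (fun t => Sum.inr ((j + t * k : ℕ) : ZMod (6 * k)))

def fullSet (k : ℕ) (X Y : ℕ → ℕ) : Finset (ZMod (6 * k) ⊕ ZMod (6 * k)) :=
  (Finset.range k).biUnion (colSet k X Y)

/-- Number of bits. -/
def nb (x : ℕ) : ℕ := ((Finset.range 6).filter (fun t => x.testBit t)).card

theorem card_fullSet (k : ℕ) (X Y : ℕ → ℕ) :
    (fullSet k X Y).card ≤ ∑ j ∈ Finset.range k, (nb (X j) + nb (Y j)) := by
  refine Finset.card_biUnion_le.trans (Finset.sum_le_sum fun j _ => ?_)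
  exact (Finset.card_union_le _ _).trans (Nat.add_le_add Finset.card_image_le Finset.card_image_le)

theorem mem_inl {k : ℕ} {X Y : ℕ → ℕ} {j t : ℕ} (hj : j < k) (ht : t < 6)
    (h : (X j).testBit t = true) :
    Sum.inl ((j + t * k : ℕ) : ZMod (6 * k)) ∈ fullSet k X Y := by
  refine Finset.mem_biUnion.mpr ⟨j, Finset.mem_range.mpr hj, Finset.mem_union_left _ ?_⟩
  exact Finset.mem_image.mpr ⟨t, by simp [ht, h], rfl⟩

theorem mem_inr {k : ℕ} {X Y : ℕ → ℕ} {j t : ℕ} (hj : j < k) (ht : t < 6)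
    (h : (Y j).testBit t = true) :
    Sum.inr ((j + t * k : ℕ) : ZMod (6 * k)) ∈ fullSet k X Y := by
  refine Finset.mem_biUnion.mpr ⟨j, Finset.mem_range.mpr hj, Finset.mem_union_right _ ?_⟩
  exact Finset.mem_image.mpr ⟨t, by simp [ht, h], rfl⟩

/-- Local validity of a column with mask `b`, inner mask `B`, neighbouring outer masks `a`, `c`. -/
def okc (a b B c : ℕ) : Prop :=
  ∀ t < 6, (b.testBit t || B.testBit t || a.testBit t || c.testBit t) = true ∧
    (b.testBit t || B.testBit t || B.testBit ((t + 5) % 6) || B.testBit ((t + 1) % 6)) = true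

instance (a b B c : ℕ) : Decidable (okc a b B c) := by unfold okc; infer_instance

theorem rotl_bit : ∀ x < 64, ∀ t < 6, (rotl x).testBit t = x.testBit ((t + 5) % 6) := by
  decide +kernel

theorem rotr_bit : ∀ x < 64, ∀ t < 6, (rotr x).testBit t = x.testBit ((t + 1) % 6) := by
  decide +kernel

theorem cast_mod (k s : ℕ) (j : ℕ) :
    ((j + s % 6 * k : ℕ) : ZMod (6 * k)) = ((j + s * k : ℕ) : ZMod (6 * k)) := by
  rw [ZMod.natCast_eq_natCast_iff]
  have h : j + s * k = (j + s % 6 * k) + 6 * k * (s / 6) := by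
    have := Nat.mod_add_div s 6
    calc j + s * k = j + (s % 6 + 6 * (s / 6)) * k := by rw [this]
      _ = _ := by ring
  rw [h]
  simp [Nat.ModEq]

theorem dominating_fullSet (k : ℕ) (hk : 1 ≤ k) (X Y : ℕ → ℕ) (hX : ∀ j < k, X j < 64)
    (h : ∀ j < k, okc (if j = 0 then rotl (X (k - 1)) else X (j - 1)) (X j) (Y j)
      (if j + 1 = k then rotr (X 0) else X (j + 1))) :
    IsDominating (petersen (6 * k) k) ↑(fullSet k X Y) := by
  have : NeZero (6 * k) := ⟨by omega⟩
  have rep : ∀ i : ZMod (6 * k), ∃ j t, j < k ∧ t < 6 ∧ i = ((j + t * k : ℕ) : ZMod (6 * k)) := by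
    intro i
    refine ⟨i.val % k, i.val / k, Nat.mod_lt _ hk, ?_, ?_⟩
    · exact Nat.div_lt_of_lt_mul (lt_of_lt_of_eq (ZMod.val_lt i) (Nat.mul_comm 6 k))
    · rw [Nat.mod_add_div', ZMod.natCast_zmod_val]
  have fin : ∀ u v : ZMod (6 * k) ⊕ ZMod (6 * k), u ∈ fullSet k X Y →
      (u ≠ v → (petersen (6 * k) k).Adj u v) →
      v ∈ (↑(fullSet k X Y) : Set (ZMod (6 * k) ⊕ ZMod (6 * k))) ∨
      ∃ u ∈ (↑(fullSet k X Y) : Set (ZMod (6 * k) ⊕ ZMod (6 * k))),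
        (petersen (6 * k) k).Adj u v := by
    intro u v hu huv
    by_cases e : u = v
    · left; subst e; exact hu
    · right; exact ⟨u, hu, huv e⟩
  have six := six_k (k := k)
  intro v
  rcases v with i | i
  · obtain ⟨j, t, hj, ht, rfl⟩ := rep i
    have H := (h j hj t ht).1
    simp only [Bool.or_eq_true] at H
    rcases H with ((H | H) | H) | H
    · left; exact mem_inl hj ht H
    · refine fin _ _ (mem_inr hj ht H) fun hne => ?_
      simp only [petersen, SimpleGraph.fromRel_adj]
      exact ⟨hne, Or.inr trivial⟩
    · by_cases h0 : j = 0
      · rw [if_pos h0, rotl_bit _ (hX _ (by omega)) t ht] at H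
        refine fin _ _ (mem_inl (by omega) (Nat.mod_lt _ (by omega)) H) fun hne => ?_
        simp only [petersen, SimpleGraph.fromRel_adj]
        refine ⟨hne, Or.inl ?_⟩
        rw [cast_mod]
        subst h0
        obtain ⟨k, rfl⟩ : ∃ l, k = l + 1 := ⟨k - 1, by omega⟩
        push_cast at six ⊢
        linear_combination -six
      · rw [if_neg h0] at H
        refine fin _ _ (mem_inl (by omega) ht H) fun hne => ?_
        simp only [petersen, SimpleGraph.fromRel_adj]
        refine ⟨hne, Or.inl ?_⟩
        obtain ⟨j, rfl⟩ : ∃ l, j = l + 1 := ⟨j - 1, by omega⟩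
        push_cast
        ring
    · by_cases h0 : j + 1 = k
      · rw [if_pos h0, rotr_bit _ (hX _ (by omega)) t ht] at H
        refine fin _ _ (mem_inl (by omega) (Nat.mod_lt _ (by omega)) H) fun hne => ?_
        simp only [petersen, SimpleGraph.fromRel_adj]
        refine ⟨hne, Or.inr ?_⟩
        rw [cast_mod]
        subst h0
        push_cast
        ring
      · rw [if_neg h0] at H
        refine fin _ _ (mem_inl (by omega) ht H) fun hne => ?_
        simp only [petersen, SimpleGraph.fromRel_adj]
        refine ⟨hne, Or.inr ?_⟩
        push_cast
        ring
  · obtain ⟨j, t, hj, ht, rfl⟩ := rep i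
    have H := (h j hj t ht).2
    simp only [Bool.or_eq_true] at H
    rcases H with ((H | H) | H) | H
    · refine fin _ _ (mem_inl hj ht H) fun hne => ?_
      simp only [petersen, SimpleGraph.fromRel_adj]
      exact ⟨hne, Or.inl trivial⟩
    · left; exact mem_inr hj ht H
    · refine fin _ _ (mem_inr hj (Nat.mod_lt _ (by omega)) H) fun hne => ?_
      simp only [petersen, SimpleGraph.fromRel_adj]
      refine ⟨hne, Or.inl ?_⟩
      rw [cast_mod]
      push_cast
      linear_combination -six
    · refine fin _ _ (mem_inr hj (Nat.mod_lt _ (by omega)) H) fun hne => ?_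
      simp only [petersen, SimpleGraph.fromRel_adj]
      refine ⟨hne, Or.inr ?_⟩
      rw [cast_mod]
      push_cast
      ring

/-- Masks: `q` copies of a period-3 block, followed by a closing block. -/
def seq (C D : ℕ → ℕ) (q j : ℕ) : ℕ := if j < 3 * q then C (j % 3) else D (j - 3 * q)

def CX (s : ℕ) : ℕ := [8, 18, 1].getD s 0
def CY (_ : ℕ) : ℕ := 36

theorem seq_lo (C D : ℕ → ℕ) {q p s : ℕ} (hp : p < q) (hs : s < 3) :
    seq C D q (3 * p + s) = C s := by
  unfold seq
  rw [if_pos (by omega)]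
  congr 1
  omega

theorem seq_hi (C D : ℕ → ℕ) (q s : ℕ) : seq C D q (3 * q + s) = D s := by
  unfold seq
  rw [if_neg (by omega)]
  congr 1
  omega

theorem sum_seq (q L : ℕ) (DX DY : ℕ → ℕ) :
    ∑ j ∈ Finset.range (3 * q + L), (nb (seq CX DX q j) + nb (seq CY DY q j)) =
      10 * q + ∑ j ∈ Finset.range L, (nb (DX j) + nb (DY j)) := by
  rw [Finset.sum_range_add]
  congr 1
  · have : ∀ p ≤ q, ∑ j ∈ Finset.range (3 * p), (nb (seq CX DX q j) + nb (seq CY DY q j))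
        = 10 * p := by
      intro p
      induction p with
      | zero => simp
      | succ p ih =>
        intro hp
        have e : 3 * (p + 1) = 3 * p + 3 := by ring
        rw [e, Finset.sum_range_add, ih (by omega)]
        have : ∑ s ∈ Finset.range 3, (nb (seq CX DX q (3 * p + s)) + nb (seq CY DY q (3 * p + s)))
            = ∑ s ∈ Finset.range 3, (nb (CX s) + nb (CY s)) := by
          refine Finset.sum_congr rfl fun s hs => ?_
          have hs := Finset.mem_range.mp hs
          rw [seq_lo _ _ (by omega) hs, seq_lo _ _ (by omega) hs]
        rw [this]
        have : ∑ s ∈ Finset.range 3, (nb (CX s) + nb (CY s)) = 10 := by decide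
        omega
    exact this q le_rfl
  · refine Finset.sum_congr rfl fun s _ => ?_
    rw [seq_hi, seq_hi]

theorem seq_ok (q L : ℕ) (hL : 2 ≤ L) (DX DY : ℕ → ℕ) (h64 : ∀ s < L, DX s < 64)
    (h0 : DX 0 = 8) (hl : DX (L - 1) = 32)
    (h : ∀ s < L, okc (if s = 0 then 1 else DX (s - 1)) (DX s) (DY s)
      (if s + 1 = L then 4 else DX (s + 1))) :
    IsDominating (petersen (6 * (3 * q + L)) (3 * q + L))
      ↑(fullSet (3 * q + L) (seq CX DX q) (seq CY DY q)) := by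
  have first : seq CX DX q 0 = 8 := by
    rcases Nat.eq_zero_or_pos q with rfl | hq
    · exact h0
    · exact seq_lo CX DX (p := 0) (s := 0) hq (by omega)
  have last : seq CX DX q (3 * q + L - 1) = 32 := by
    have : 3 * q + L - 1 = 3 * q + (L - 1) := by omega
    rw [this, seq_hi, hl]
  have start : ∀ p ≤ q, seq CX DX q (3 * p) = 8 := by
    intro p hp
    rcases Nat.lt_or_eq_of_le hp with hp | rfl
    · exact seq_lo CX DX (s := 0) hp (by omega)
    · exact (seq_hi CX DX p 0).trans h0
  have before : ∀ p ≤ q, (if 3 * p = 0 then rotl (seq CX DX q (3 * q + L - 1))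
      else seq CX DX q (3 * p - 1)) = 1 := by
    intro p hp
    rcases Nat.eq_zero_or_pos p with rfl | hp0
    · rw [if_pos rfl, last]; decide
    · rw [if_neg (by omega)]
      have : 3 * p - 1 = 3 * (p - 1) + 2 := by omega
      rw [this, seq_lo _ _ (by omega) (by omega)]; decide
  have split : ∀ j < 3 * q + L, (∃ p s, p < q ∧ s < 3 ∧ j = 3 * p + s) ∨ ∃ s < L, j = 3 * q + s := by
    intro j hj
    by_cases hjq : j < 3 * q
    · exact Or.inl ⟨j / 3, j % 3, by omega, by omega, by omega⟩
    · exact Or.inr ⟨j - 3 * q, by omega, by omega⟩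
  apply dominating_fullSet _ (by omega)
  · intro j hj
    rcases split j hj with ⟨p, s, hp, hs, rfl⟩ | ⟨s, hs, rfl⟩
    · rw [seq_lo _ _ hp hs]
      interval_cases s <;> decide
    · rw [seq_hi]; exact h64 s hs
  · intro j hj
    rw [first]
    rcases split j hj with ⟨p, s, hp, hs, rfl⟩ | ⟨s, hs, rfl⟩
    · rw [if_neg (show ¬ (3 * p + s + 1 = 3 * q + L) by omega), seq_lo CX _ hp hs,
        seq_lo CY _ hp hs]
      interval_cases s
      · rw [Nat.add_zero, before p hp.le, seq_lo CX DX hp (by omega)]; decide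
      · rw [if_neg (by omega), Nat.add_sub_cancel, add_assoc, seq_lo CX DX hp (by omega),
          show 3 * p = 3 * p + 0 from rfl, seq_lo CX DX hp (by omega)]; decide
      · rw [if_neg (by omega), show 3 * p + 2 - 1 = 3 * p + 1 by omega,
          seq_lo CX DX hp (by omega), show 3 * p + 2 + 1 = 3 * (p + 1) by omega,
          start _ (by omega)]; decide
    · rw [seq_hi, seq_hi]
      have H := h s hs
      have e1 : (if 3 * q + s = 0 then rotl (seq CX DX q (3 * q + L - 1))
          else seq CX DX q (3 * q + s - 1)) = if s = 0 then 1 else DX (s - 1) := by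
        rcases Nat.eq_zero_or_pos s with rfl | hs0
        · exact before q le_rfl
        · rw [if_neg (by omega), if_neg (by omega),
            show 3 * q + s - 1 = 3 * q + (s - 1) by omega, seq_hi]
      have e2 : (if 3 * q + s + 1 = 3 * q + L then rotr 8 else seq CX DX q (3 * q + s + 1))
          = if s + 1 = L then 4 else DX (s + 1) := by
        by_cases hsL : s + 1 = L
        · rw [if_pos (by omega), if_pos hsL]; decide
        · rw [if_neg (by omega), if_neg hsL, add_assoc, seq_hi]
      rw [e1, e2]
      exact H

theorem gamma_le {V : Type*} {G : SimpleGraph V} {S : Finset V} (h : IsDominating G ↑S) :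
    gamma G ≤ S.card := Nat.sInf_le ⟨S, h, rfl⟩

theorem le_gamma {V : Type*} {G : SimpleGraph V} {m : ℕ} (hne : ∃ S : Finset V, IsDominating G ↑S)
    (h : ∀ S : Finset V, IsDominating G ↑S → m ≤ S.card) : m ≤ gamma G := by
  obtain ⟨S, hS⟩ := hne
  obtain ⟨T, hT, hc⟩ := Nat.sInf_mem (s := {m | ∃ S : Finset V, IsDominating G ↑S ∧ S.card = m})
    ⟨_, S, hS, rfl⟩
  have := h T hT
  unfold gamma
  omega

theorem upper (k : ℕ) (hk : 1 ≤ k) (hk2 : k ≠ 2) :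
    ∃ S : Finset (ZMod (6 * k) ⊕ ZMod (6 * k)), IsDominating (petersen (6 * k) k) ↑S ∧
      S.card ≤ (10 * k + 2) / 3 := by
  by_cases h1 : k = 1
  · subst h1
    refine ⟨fullSet 1 (fun _ => 9) (fun _ => 9), dominating_fullSet 1 le_rfl _ _ ?_ ?_, ?_⟩
    · decide
    · decide
    · refine (card_fullSet _ _ _).trans ?_
      decide
  · have hq : ∃ q, k = 3 * q + 3 ∨ k = 3 * q + 4 ∨ k = 3 * q + 5 := ⟨k / 3 - 1, by omega⟩
    obtain ⟨q, rfl | rfl | rfl⟩ := hq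
    · refine ⟨_, seq_ok q 3 (by omega) (fun s => [8, 18, 32].getD s 0)
        (fun s => [36, 5, 9].getD s 0) (by decide) (by decide) (by decide) (by decide), ?_⟩
      refine (card_fullSet _ _ _).trans ?_
      rw [sum_seq]
      have : ∑ j ∈ Finset.range 3, (nb ([8, 18, 32].getD j 0) + nb ([36, 5, 9].getD j 0)) = 10 := by
        decide
      omega
    · refine ⟨_, seq_ok q 4 (by omega) (fun s => [8, 18, 9, 32].getD s 0)
        (fun s => [36, 36, 20, 18].getD s 0) (by decide) (by decide) (by decide) (by decide), ?_⟩
      refine (card_fullSet _ _ _).trans ?_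
      rw [sum_seq]
      have : ∑ j ∈ Finset.range 4, (nb ([8, 18, 9, 32].getD j 0) + nb ([36, 36, 20, 18].getD j 0))
          = 14 := by
        decide
      omega
    · refine ⟨_, seq_ok q 5 (by omega) (fun s => [8, 36, 2, 9, 32].getD s 0)
        (fun s => [18, 17, 18, 20, 18].getD s 0) (by decide) (by decide) (by decide)
        (by decide), ?_⟩
      refine (card_fullSet _ _ _).trans ?_
      rw [sum_seq]
      have : ∑ j ∈ Finset.range 5,
          (nb ([8, 36, 2, 9, 32].getD j 0) + nb ([18, 17, 18, 20, 18].getD j 0)) = 17 := by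
        decide
      omega

theorem upper12 : ∃ S : Finset (ZMod (6 * 2) ⊕ ZMod (6 * 2)),
    IsDominating (petersen (6 * 2) 2) ↑S ∧ S.card ≤ 8 := by
  refine ⟨fullSet 2 (fun s => [0, 9].getD s 0) (fun s => [36, 54].getD s 0),
    dominating_fullSet 2 (by omega) _ _ ?_ ?_, ?_⟩
  · decide
  · decide
  · refine (card_fullSet _ _ _).trans ?_
    decide

end upper

end P6k

theorem gamma_P6k (k : ℕ) (hk : 1 ≤ k) :
    (k ≠ 2 → gamma (petersen (6 * k) k) = (10 * k + 2) / 3) ∧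
    gamma (petersen 12 2) = 8 := by
  constructor
  · intro hk2
    obtain ⟨S, hS, hc⟩ := P6k.upper k hk hk2
    refine le_antisymm ((P6k.gamma_le hS).trans hc) (P6k.le_gamma ⟨S, hS⟩ fun T hT => ?_)
    have := P6k.lower hk hT
    omega
  · obtain ⟨S, hS, hc⟩ := P6k.upper12
    exact le_antisymm ((P6k.gamma_le hS).trans hc)
      (P6k.le_gamma ⟨S, hS⟩ fun T hT => P6k.lower12 hT)
end
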